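/- arXiv:1402.7093 — 7 statements merged into one kernel-verified Lean document; each statement's English description precedes it below -/
import Mathlib

section
/- Let Ω₀ be a finite set, λ a real matrix indexed by Ω₀ × Ω₀, and a ⊆ Ω₀ absorbing for λ. Let α be a real row vector indexed by Ω₀ with α(i) = 0 for all i ∈ a. Then for every u ≥ 0, α exp(u · I_{aᶜ} λ I_{aᶜ}) = α exp(uλ) I_{aᶜ}. (Matrix form of Proposition 4.1: for absorbing a, the taboo transition vector α e^{u𝛌(aᶜ)} equals α e^{uλ} I_{aᶜ}.) -/
open Matrix
open scoped Classical

/-- `indMat a` is the diagonal 0–1 matrix `I_a` with `I_a(i,i) = 1` iff `i ∈ a`. -/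
noncomputable def indMat {Ω₀ : Type*} [Fintype Ω₀] [DecidableEq Ω₀] (a : Set Ω₀) :
    Matrix Ω₀ Ω₀ ℝ :=
  Matrix.diagonal (fun i => if i ∈ a then 1 else 0)

/-- `bl lam a b` is the matrix `𝛌(a,b)`: equal to `lam` on `a × b` entries and `0` elsewhere. -/
noncomputable def bl {Ω₀ : Type*} [Fintype Ω₀] [DecidableEq Ω₀]
    (lam : Matrix Ω₀ Ω₀ ℝ) (a b : Set Ω₀) : Matrix Ω₀ Ω₀ ℝ :=
  Matrix.of fun i j => if i ∈ a ∧ j ∈ b then lam i j else 0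

/-- `a` is absorbing for `lam` if `lam i j = 0` whenever `i ∈ a` and `j ∉ a`. -/
def Absorbing {Ω₀ : Type*} (lam : Matrix Ω₀ Ω₀ ℝ) (a : Set Ω₀) : Prop :=
  ∀ i ∈ a, ∀ j ∉ a, lam i j = 0

/-- Proposition 4.1, matrix form: if `a` is absorbing and `α` vanishes on `a`,
then `α exp(u 𝛌(aᶜ)) = α exp(uλ) I_{aᶜ}` for all `u ≥ 0`. -/
theorem vecMul_exp_taboo_eq_of_absorbing {Ω₀ : Type*} [Fintype Ω₀] [DecidableEq Ω₀]
    (lam : Matrix Ω₀ Ω₀ ℝ) (a : Set Ω₀) (hab : Absorbing lam a)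
    (α : Ω₀ → ℝ) (hα : ∀ i ∈ a, α i = 0) (u : ℝ) (hu : 0 ≤ u) :
    α ᵥ* NormedSpace.exp (u • (indMat aᶜ * lam * indMat aᶜ)) =
      α ᵥ* (NormedSpace.exp (u • lam) * indMat aᶜ) := by
  have hαP : α ᵥ* indMat aᶜ = α := by
    ext i
    by_cases hi : i ∈ a <;> simp [indMat, Matrix.vecMul_diagonal, hi, hα]
  have h : SemiconjBy (indMat aᶜ) (u • (indMat aᶜ * lam * indMat aᶜ)) (u • lam) := by
    unfold SemiconjBy
    ext i j
    simp only [indMat, Matrix.mul_smul, Matrix.smul_mul, Matrix.smul_apply,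
      Matrix.diagonal_mul, Matrix.mul_diagonal, smul_eq_mul]
    by_cases hi : i ∈ a <;> by_cases hj : j ∈ a <;> simp [hi, hj]
    exact Or.inr (hab i hi j hj)
  have h2 : SemiconjBy (indMat aᶜ) (NormedSpace.exp (u • (indMat aᶜ * lam * indMat aᶜ)))
      (NormedSpace.exp (u • lam)) := by
    letI : NormedRing (Matrix Ω₀ Ω₀ ℝ) := Matrix.linftyOpNormedRing
    letI : NormedAlgebra ℝ (Matrix Ω₀ Ω₀ ℝ) := Matrix.linftyOpNormedAlgebra
    letI : NormedAlgebra ℚ (Matrix Ω₀ Ω₀ ℝ) := NormedAlgebra.restrictScalars ℚ ℝ _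
    exact h.exp_right
  rw [← h2.eq, ← Matrix.vecMul_vecMul, hαP]
end

section
/- Let Ω₀ be a finite set, λ a real matrix indexed by Ω₀ × Ω₀, K a finite index set, and Γ_k ⊆ Ω₀ for k ∈ K, with each Γ_k absorbing for λ. Let s = (s(1),…,s(m)) be an ordered partition of K and define W_n and T_n from s and the Γ_k as in the context. Let α be a real row vector indexed by Ω₀ with α(i) = 0 for every i ∈ ⋃_{k∈K} Γ_k, and let u_1,…,u_m ≥ 0. Then α (∏_{n=1}^m exp(u_n · 𝛌(W_n)) 𝛌(W_n, T_n)) 1 = α (∏_{n=1}^m exp(u_n · λ) 𝛌(W_n, T_n)) 1, where ∏_{n=1}^m M_n denotes the ordered product M_1 M_2 ⋯ M_m. (Matrix form of Proposition 4.2: in the hitting-time density formula for absorbing sets, each exponent 𝛌(W_n) may be replaced by the full matrix λ.) -/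
open Matrix
open scoped Classical

section helper
attribute [local instance] Matrix.linftyOpNormedRing Matrix.linftyOpNormedAlgebra

theorem exp_mul_eq_of_mul_eq {Ω₀ : Type*} [Fintype Ω₀] [DecidableEq Ω₀]
    (A B P : Matrix Ω₀ Ω₀ ℝ) (h : A * P = P * B) :
    NormedSpace.exp A * P = P * NormedSpace.exp B := by
  have hA := (NormedSpace.exp_series_hasSum_exp' (𝕂 := ℝ) A).mul_right P
  have hB := (NormedSpace.exp_series_hasSum_exp' (𝕂 := ℝ) B).mul_left P
  have hp : ∀ n : ℕ, A ^ n * P = P * B ^ n := by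
    intro n
    have : SemiconjBy P B A := h.symm
    exact (this.pow_right n).symm
  have hf : (fun i : ℕ => ((i.factorial : ℝ)⁻¹ • A ^ i) * P) =
      fun i : ℕ => P * ((i.factorial : ℝ)⁻¹ • B ^ i) := by
    funext n
    rw [smul_mul_assoc, mul_smul_comm, hp]
  exact hA.unique (Eq.mpr (congrArg (fun f => HasSum f (P * NormedSpace.exp B)) hf) hB)
end helper

theorem exp_factor_eq {Ω₀ : Type*} [Fintype Ω₀] [DecidableEq Ω₀]
    (lam : Matrix Ω₀ Ω₀ ℝ) (W T : Set Ω₀) (hW : Absorbing lam Wᶜ) (u : ℝ) :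
    NormedSpace.exp (u • bl lam W W) * bl lam W T =
      NormedSpace.exp (u • lam) * bl lam W T := by
  have hP : bl lam W T = indMat W * bl lam W T := by
    ext i j
    simp only [indMat, Matrix.diagonal_mul, bl, Matrix.of_apply]
    split_ifs <;> simp_all
  have h1 : bl lam W W * indMat W = indMat W * bl lam W W := by
    ext i j
    simp only [indMat, Matrix.diagonal_mul, Matrix.mul_diagonal, bl, Matrix.of_apply]
    split_ifs <;> simp_all
  have h2 : lam * indMat W = indMat W * bl lam W W := by
    ext i j
    simp only [indMat, Matrix.diagonal_mul, Matrix.mul_diagonal, bl, Matrix.of_apply]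
    by_cases hi : i ∈ W <;> by_cases hj : j ∈ W <;> simp [hi, hj]
    exact hW i hi j (by simpa using hj)
  rw [hP, ← mul_assoc, ← mul_assoc,
    exp_mul_eq_of_mul_eq (u • bl lam W W) (u • bl lam W W) (indMat W)
      (by rw [smul_mul_assoc, mul_smul_comm, h1]),
    exp_mul_eq_of_mul_eq (u • lam) (u • bl lam W W) (indMat W)
      (by rw [smul_mul_assoc, mul_smul_comm, h2])]

/-- Proposition 4.2, matrix form: for absorbing sets `Γ_k` and an ordered
partition `s` of `K`, with `W_n`, `T_n` the waiting and target sets, and `α` vanishing on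
`⋃ Γ_k`, the exponents `𝛌(W_n)` in the hitting-time density formula may be replaced by `λ`. -/
theorem density_formula_exp_full_matrix_of_absorbing
    {Ω₀ K : Type*} [Fintype Ω₀] [DecidableEq Ω₀] [Fintype K]
    (lam : Matrix Ω₀ Ω₀ ℝ) (Γ : K → Set Ω₀) (hΓ : ∀ k, Absorbing lam (Γ k))
    (m : ℕ) (s : Fin m → Set K)
    (hne : ∀ n, (s n).Nonempty)
    (hdisj : ∀ n n', n ≠ n' → Disjoint (s n) (s n'))
    (hcover : (⋃ n, s n) = Set.univ)
    (W T : Fin m → Set Ω₀)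
    (hW : W = fun n => (⋃ m' : Fin m, ⋃ (_ : n ≤ m'), ⋃ k ∈ s m', Γ k)ᶜ)
    (hT : T = fun n =>
      (⋂ k ∈ s n, Γ k) ∩ (⋃ m' : Fin m, ⋃ (_ : n < m'), ⋃ k ∈ s m', Γ k)ᶜ)
    (α : Ω₀ → ℝ) (hα : ∀ i ∈ ⋃ k, Γ k, α i = 0)
    (u : Fin m → ℝ) (hu : ∀ n, 0 ≤ u n) :
    (α ᵥ* (List.ofFn fun n =>
        NormedSpace.exp (u n • bl lam (W n) (W n)) * bl lam (W n) (T n)).prod) ⬝ᵥ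
      (fun _ => (1 : ℝ)) =
    (α ᵥ* (List.ofFn fun n =>
        NormedSpace.exp (u n • lam) * bl lam (W n) (T n)).prod) ⬝ᵥ
      (fun _ => (1 : ℝ)) := by
  have key : ∀ n, Absorbing lam (W n)ᶜ := by
    intro n i hi j hj
    subst hW
    simp only [compl_compl, Set.mem_iUnion, not_exists] at hi hj
    obtain ⟨m', hm, k, hk, hik⟩ := hi
    exact hΓ k i hik j (hj m' hm k hk)
  simp only [fun n => exp_factor_eq lam (W n) (T n) (key n) (u n)]
end

section
/- Let Ω₀ be a finite set, λ a real matrix indexed by Ω₀ × Ω₀, K a finite index set, and Γ_k ⊆ Ω₀ for k ∈ K, with each Γ_k absorbing for λ. Let s = (s(1),…,s(m)) be an ordered partition of K and define W_n and T_n from s and the Γ_k as in the context. Further define T̂_0 := (⋃_{k∈K} Γ_k)ᶜ, and for 1 ≤ n ≤ m: T̂_n := (⋂_{k ∈ s(1)∪⋯∪s(n)} Γ_k) \ (⋃_{m'=n+1}^{m} ⋃_{k∈s(m')} Γ_k), and Ŵ_n := T̂_{n−1}. Let α be a real row vector indexed by Ω₀ with α(i) = 0 for every i ∈ ⋃_{k∈K}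 Γ_k, and let u_1,…,u_m ≥ 0. Then α (∏_{n=1}^m exp(u_n · 𝛌(W_n)) 𝛌(W_n, T_n)) 1 = α (∏_{n=1}^m exp(u_n · 𝛌(Ŵ_n)) 𝛌(Ŵ_n, T̂_n)) 1, where ∏_{n=1}^m M_n denotes the ordered product M_1 M_2 ⋯ M_m. (The hitting-time density formula continues to hold when the waiting and target sets W_n, T_n are replaced by Ŵ_n, T̂_n.) -/
open Matrix
open scoped Classical

section ExpSemiconj
attribute [local instance] Matrix.linftyOpNormedRing Matrix.linftyOpNormedAlgebra

theorem mat_semiconj_exp {Ω₀ : Type*} [Fintype Ω₀] [DecidableEq Ω₀]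
    {P A B : Matrix Ω₀ Ω₀ ℝ} (h : P * A = B * P) :
    P * NormedSpace.exp A = NormedSpace.exp B * P := by
  letI : NormedAlgebra ℚ (Matrix Ω₀ Ω₀ ℝ) := NormedAlgebra.restrictScalars ℚ ℝ _
  have h' : SemiconjBy P A B := h
  exact h'.exp_right
end ExpSemiconj

theorem prod_ofFn_absorb {R : Type*} [Monoid R] (P : ℕ → R) (hP0 : P 0 = 1) :
    ∀ (m : ℕ) (M N : Fin m → R) (_ : ∀ n : Fin m, P n.val * M n = N n)
      (_ : ∀ n : Fin m, N n * P (n.val + 1) = N n),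
      (List.ofFn M).prod = (List.ofFn N).prod ∧
        (List.ofFn N).prod * P m = (List.ofFn N).prod := by
  intro m
  induction m with
  | zero => intro M N _ _; simp [hP0]
  | succ m ih =>
    intro M N h h'
    obtain ⟨h1, h2⟩ := ih (fun i => M i.castSucc) (fun i => N i.castSucc)
      (fun n => h n.castSucc) (fun n => h' n.castSucc)
    have hl := h (Fin.last m)
    have hl' := h' (Fin.last m)
    rw [Fin.val_last] at hl hl'
    rw [List.ofFn_succ_last, List.ofFn_succ_last]
    simp only [List.prod_append, List.prod_singleton]
    refine ⟨?_, by rw [mul_assoc, hl']⟩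
    rw [h1, ← hl, ← mul_assoc, h2]

theorem indMat_mul_bl {Ω₀ : Type*} [Fintype Ω₀] [DecidableEq Ω₀]
    (lam : Matrix Ω₀ Ω₀ ℝ) (C a b a' b' : Set Ω₀) (hC : Absorbing lam C)
    (ha : a' = C ∩ a) (hb : C ∩ b = C ∩ b') (hb' : b' ⊆ C) :
    indMat C * bl lam a b = bl lam a' b' := by
  subst ha
  ext i j
  rw [indMat, Matrix.diagonal_mul]
  simp only [bl, Matrix.of_apply, Set.mem_inter_iff]
  by_cases hi : i ∈ C
  · by_cases hj : j ∈ C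
    · have : j ∈ b ↔ j ∈ b' := by
        have := Set.ext_iff.1 hb j
        simpa [hj] using this
      simp [hi, this]
    · have := hC i hi j hj
      simp [this]
  · simp [hi]

theorem bl_mul_indMat {Ω₀ : Type*} [Fintype Ω₀] [DecidableEq Ω₀]
    (lam : Matrix Ω₀ Ω₀ ℝ) (C a b : Set Ω₀) (hb : b ⊆ C) :
    bl lam a b * indMat C = bl lam a b := by
  ext i j
  rw [indMat, Matrix.mul_diagonal]
  simp only [bl, Matrix.of_apply]
  by_cases hj : j ∈ b
  · simp [hb hj]
  · simp [hj]

/-- for absorbing `Γ_k`, the hitting-time density formula continues to hold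
when the waiting and target sets `W_n, T_n` are replaced by `Ŵ_n := T̂_{n-1}` and `T̂_n`,
where `T̂_0 := (⋃_k Γ_k)ᶜ` and
`T̂_n := (⋂_{k ∈ s(1)∪⋯∪s(n)} Γ_k) \ (⋃_{m'>n} ⋃_{k ∈ s(m')} Γ_k)` for `1 ≤ n ≤ m`. -/
theorem density_formula_hat_sets_of_absorbing
    {Ω₀ K : Type*} [Fintype Ω₀] [DecidableEq Ω₀] [Fintype K]
    (lam : Matrix Ω₀ Ω₀ ℝ) (Γ : K → Set Ω₀) (hΓ : ∀ k, Absorbing lam (Γ k))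
    (m : ℕ) (s : Fin m → Set K)
    (hne : ∀ n, (s n).Nonempty)
    (hdisj : ∀ n n', n ≠ n' → Disjoint (s n) (s n'))
    (hcover : (⋃ n, s n) = Set.univ)
    (W T : Fin m → Set Ω₀)
    (hW : W = fun n => (⋃ m' : Fin m, ⋃ (_ : n ≤ m'), ⋃ k ∈ s m', Γ k)ᶜ)
    (hT : T = fun n =>
      (⋂ k ∈ s n, Γ k) ∩ (⋃ m' : Fin m, ⋃ (_ : n < m'), ⋃ k ∈ s m', Γ k)ᶜ)
    (That : ℕ → Set Ω₀)
    (hThat0 : That 0 = (⋃ k, Γ k)ᶜ)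
    (hThat : ∀ n : Fin m, That (n.val + 1) =
      (⋂ m' : Fin m, ⋂ (_ : m' ≤ n), ⋂ k ∈ s m', Γ k) \
        (⋃ m' : Fin m, ⋃ (_ : n < m'), ⋃ k ∈ s m', Γ k))
    (α : Ω₀ → ℝ) (hα : ∀ i ∈ ⋃ k, Γ k, α i = 0)
    (u : Fin m → ℝ) (hu : ∀ n, 0 ≤ u n) :
    (α ᵥ* (List.ofFn fun n =>
        NormedSpace.exp (u n • bl lam (W n) (W n)) * bl lam (W n) (T n)).prod) ⬝ᵥ
      (fun _ => (1 : ℝ)) =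
    (α ᵥ* (List.ofFn fun n =>
        NormedSpace.exp (u n • bl lam (That n.val) (That n.val)) *
          bl lam (That n.val) (That (n.val + 1))).prod) ⬝ᵥ
      (fun _ => (1 : ℝ)) := by
  let C : ℕ → Set Ω₀ := fun n => {i | ∀ m' : Fin m, m'.val < n → ∀ k ∈ s m', i ∈ Γ k}
  let U : ℕ → Set Ω₀ := fun n => {i | ∀ m' : Fin m, n ≤ m'.val → ∀ k ∈ s m', i ∉ Γ k}
  have hCabs : ∀ n, Absorbing lam (C n) := by
    intro n i hi j hj
    simp only [C, Set.mem_setOf_eq] at hi hj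
    push Not at hj
    obtain ⟨m', hm', k, hk, hjk⟩ := hj
    exact hΓ k i (hi m' hm' k hk) j hjk
  have hsucc : ∀ n : Fin m, That (n.val + 1) = C (n.val + 1) ∩ U (n.val + 1) := by
    intro n
    rw [hThat]
    ext i
    simp only [C, U, Set.mem_diff, Set.mem_iInter, Set.mem_iUnion, Set.mem_inter_iff,
      Set.mem_setOf_eq, Fin.le_def, Fin.lt_def, Nat.lt_succ_iff, Nat.succ_le_iff]
    push Not
    rfl
  have hzero : That 0 = C 0 ∩ U 0 := by
    rw [hThat0]
    ext i
    simp only [C, U, Set.mem_compl_iff, Set.mem_iUnion, Set.mem_inter_iff, Set.mem_setOf_eq]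
    push Not
    constructor
    · intro h
      exact ⟨fun m' h0 => absurd h0 (Nat.not_lt_zero _), fun m' _ k _ => h k⟩
    · rintro ⟨-, h⟩ k
      have hk : k ∈ ⋃ n, s n := hcover ▸ Set.mem_univ k
      obtain ⟨n, hn⟩ := Set.mem_iUnion.1 hk
      exact h n (Nat.zero_le _) k hn
  have hTh : ∀ n : Fin m, That n.val = C n.val ∩ U n.val := by
    rintro ⟨n, hn⟩
    cases n with
    | zero => exact hzero
    | succ n => exact hsucc ⟨n, by omega⟩
  have hWU : ∀ n, W n = U n.val := by
    intro n
    rw [hW]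
    ext i
    simp only [U, Set.mem_compl_iff, Set.mem_iUnion, Set.mem_setOf_eq, Fin.le_def]
    push Not
    rfl
  have hCT : ∀ n : Fin m, C n.val ∩ T n = That (n.val + 1) := by
    intro n
    rw [hsucc, hT]
    ext i
    simp only [C, U, Set.mem_compl_iff, Set.mem_iInter, Set.mem_iUnion, Set.mem_inter_iff,
      Set.mem_setOf_eq, Fin.lt_def, Nat.succ_le_iff, Nat.lt_succ_iff]
    push Not
    constructor
    · rintro ⟨h1, h2, h3⟩
      refine ⟨fun m' hm' => ?_, h3⟩
      rcases Nat.lt_or_eq_of_le hm' with h | h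
      · exact h1 m' h
      · rw [Fin.ext h]; exact h2
    · rintro ⟨h1, h3⟩
      exact ⟨fun m' hm' => h1 m' hm'.le, h1 n le_rfl, h3⟩
  have hsub : ∀ n : Fin m, That (n.val + 1) ⊆ C n.val := fun n => by
    rw [← hCT]; exact Set.inter_subset_left
  have hsub0 : ∀ n : Fin m, That n.val ⊆ C n.val := fun n => by
    rw [hTh]; exact Set.inter_subset_left
  have key := (prod_ofFn_absorb (fun n => indMat (C n)) (by simp [indMat, C]) m
    (fun n => NormedSpace.exp (u n • bl lam (W n) (W n)) * bl lam (W n) (T n))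
    (fun n => NormedSpace.exp (u n • bl lam (That n.val) (That n.val)) *
          bl lam (That n.val) (That (n.val + 1))) ?_ ?_).1
  · rw [key]
  · intro n
    have hTW : That n.val = C n.val ∩ W n := by rw [hTh, hWU]
    have h1 : indMat (C n.val) * bl lam (W n) (W n) = bl lam (That n.val) (That n.val) :=
      indMat_mul_bl lam _ _ _ _ _ (hCabs _) hTW
        (by rw [hTW, ← Set.inter_assoc, Set.inter_self]) (hsub0 n)
    have h2 : indMat (C n.val) * bl lam (W n) (T n) =
        bl lam (That n.val) (That (n.val + 1)) :=
      indMat_mul_bl lam _ _ _ _ _ (hCabs _) hTW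
        (by rw [← hCT, ← Set.inter_assoc, Set.inter_self]) (hsub n)
    have h3 : indMat (C n.val) * (u n • bl lam (W n) (W n)) =
        (u n • bl lam (That n.val) (That n.val)) * indMat (C n.val) := by
      rw [Matrix.mul_smul, h1, Matrix.smul_mul, bl_mul_indMat lam _ _ _ (hsub0 n)]
    rw [← mul_assoc, mat_semiconj_exp h3, mul_assoc, h2]
  · intro n
    rw [mul_assoc, bl_mul_indMat]
    rw [hsucc]; exact Set.inter_subset_left
end

section
/- Let (Ω, 𝓕, μ) be a probability space with Ω a standard Borel space, let 𝒢 be a sub-σ-algebra of 𝓕, and let κ denote the conditional expectation kernel of μ given 𝒢 (a regular conditional probability of μ given 𝒢). Let S₁ and S₂ be measurable spaces, Y₁ : Ω → S₁ a 𝒢-measurable random variable, Y₂ : Ω → S₂ a measurable random variable, and g : S₁ × S₂ → ℝ a bounded measurable function. Then for μ-almost every ω, E[ g(Y₁, Y₂) | 𝒢 ](ω) = ∫_Ω g(Y₁(ω), Y₂(ω')) dκ(ω)(ω'); that is, the conditional expectation of g(Y₁,Y₂) given 𝒢 is obtained by freezing the 𝒢-measurable argument Y₁ and integrating out Y₂ against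 the regular conditional distribution. -/
open MeasureTheory ProbabilityTheory

/-- Strong measurability of a kernel integral, on arbitrary spaces. -/
theorem frozen_aux_meas {A B : Type*} [MeasurableSpace A] [MeasurableSpace B]
    (κ : Kernel A B) [IsMarkovKernel κ] (f : A × B → ℝ) (hf : Measurable f) :
    StronglyMeasurable (fun a => ∫ b, f (a, b) ∂(κ a)) :=
  hf.stronglyMeasurable.integral_kernel_prod_right'

/-- Set integrals of a bounded function against a composition-product. -/
theorem frozen_aux_set {A B : Type*} [MeasurableSpace A] [MeasurableSpace B]
    (ν : Measure A) [IsProbabilityMeasure ν]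
    (κ : Kernel A B) [IsMarkovKernel κ] (f : A × B → ℝ) (hf : Measurable f)
    (C : ℝ) (hC : ∀ p, |f p| ≤ C) (s : Set A) (hs : MeasurableSet s) :
    ∫ a in s, ∫ b, f (a, b) ∂(κ a) ∂ν = ∫ p in s ×ˢ Set.univ, f p ∂(ν ⊗ₘ κ) := by
  have hi : Integrable f (ν ⊗ₘ κ) :=
    Integrable.of_bound hf.aestronglyMeasurable C (Filter.Eventually.of_forall hC)
  rw [Measure.setIntegral_compProd hs MeasurableSet.univ hi.integrableOn]
  simp

/-- Set integrals against a pushforward along a map into a product. -/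
theorem frozen_aux_map {Ω A B : Type*} [MeasurableSpace Ω] [MeasurableSpace A]
    [MeasurableSpace B] (μ : Measure Ω) (d : Ω → A × B) (hd : Measurable d)
    (f : A × B → ℝ) (hf : Measurable f) (s : Set A) (hs : MeasurableSet s) :
    ∫ p in s ×ˢ Set.univ, f p ∂(μ.map d) = ∫ ω in (fun ω => (d ω).1) ⁻¹' s, f (d ω) ∂μ := by
  rw [setIntegral_map (hs.prod MeasurableSet.univ) hf.aestronglyMeasurable hd.aemeasurable]
  congr 2
  ext; simp

/-- Lemma 3.2: freezing the `𝒢`-measurable argument. For a `𝒢`-measurable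
`Y₁`, a measurable `Y₂` and a bounded measurable `g`, the conditional expectation of
`g(Y₁, Y₂)` given `𝒢` is obtained by freezing `Y₁` and integrating `Y₂` against the
regular conditional distribution (the conditional expectation kernel). -/
theorem condexp_comp_ae_eq_integral_condexpKernel_frozen
    {Ω : Type*} {𝒢 : MeasurableSpace Ω} [mΩ : MeasurableSpace Ω] [StandardBorelSpace Ω]
    (μ : Measure Ω) [IsProbabilityMeasure μ] (h𝒢 : 𝒢 ≤ mΩ)
    {S₁ S₂ : Type*} [MeasurableSpace S₁] [MeasurableSpace S₂]
    (Y₁ : Ω → S₁) (hY₁ : Measurable[𝒢] Y₁)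
    (Y₂ : Ω → S₂) (hY₂ : Measurable Y₂)
    (g : S₁ × S₂ → ℝ) (hg : Measurable g)
    (C : ℝ) (hgC : ∀ p, |g p| ≤ C) :
    μ[(fun ω => g (Y₁ ω, Y₂ ω)) | 𝒢] =ᵐ[μ]
      fun ω => ∫ ω', g (Y₁ ω, Y₂ ω') ∂(condExpKernel μ 𝒢 ω) := by
  have hf : Measurable[𝒢.prod mΩ] (fun p : Ω × Ω => g (Y₁ p.1, Y₂ p.2)) := by
    refine hg.comp ?_
    exact @Measurable.prodMk _ (𝒢.prod mΩ) _ _ _ _ _ _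
      (hY₁.comp (@measurable_fst _ _ 𝒢 mΩ)) (hY₂.comp (@measurable_snd _ _ 𝒢 mΩ))
  have hsm : StronglyMeasurable[𝒢]
      (fun ω => ∫ ω', g (Y₁ ω, Y₂ ω') ∂(condExpKernel μ 𝒢 ω)) :=
    @frozen_aux_meas Ω Ω 𝒢 mΩ (condExpKernel μ 𝒢) _ _ hf
  have hint : Integrable (fun ω => g (Y₁ ω, Y₂ ω)) μ :=
    Integrable.of_bound
      (hg.comp ((hY₁.mono h𝒢 le_rfl).prodMk hY₂)).aestronglyMeasurable C
      (Filter.Eventually.of_forall fun _ => hgC _)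
  have hint2 : Integrable (fun ω => ∫ ω', g (Y₁ ω, Y₂ ω') ∂(condExpKernel μ 𝒢 ω)) μ := by
    refine Integrable.of_bound (hsm.mono h𝒢).aestronglyMeasurable C
      (Filter.Eventually.of_forall fun ω => ?_)
    have := norm_integral_le_of_norm_le_const (μ := condExpKernel μ 𝒢 ω)
      (f := fun ω' => g (Y₁ ω, Y₂ ω')) (C := C)
      (Filter.Eventually.of_forall fun _ => hgC _)
    simpa using this
  refine (ae_eq_condExp_of_forall_setIntegral_eq h𝒢 hint (fun _ _ _ => hint2.integrableOn)
    (fun s hs _ => ?_) hsm.aestronglyMeasurable).symm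
  have hd : @Measurable Ω (Ω × Ω) mΩ (𝒢.prod mΩ) Function.diag :=
    @Measurable.prodMk _ mΩ _ _ 𝒢 mΩ _ _ (measurable_id'' h𝒢) measurable_id
  have : IsProbabilityMeasure (μ.trim h𝒢) :=
    ⟨by rw [trim_measurableSet_eq h𝒢 MeasurableSet.univ]; exact measure_univ⟩
  have h1 := @frozen_aux_set Ω Ω 𝒢 mΩ (μ.trim h𝒢) _ (condExpKernel μ 𝒢) _ _ hf C
    (fun _ => hgC _) s hs
  rw [compProd_trim_condExpKernel h𝒢,
    @frozen_aux_map Ω Ω Ω mΩ 𝒢 mΩ μ Function.diag hd _ hf s hs] at h1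
  rw [setIntegral_trim h𝒢 hsm hs]
  exact h1
end

section
/- Let λ be an intensity matrix indexed by a finite set Ω₀ and let u ≥ 0. Then exp(uλ) is a stochastic matrix: exp(uλ)(i,j) ≥ 0 for all i, j ∈ Ω₀, and Σ_{j∈Ω₀} exp(uλ)(i,j) = 1 for every i ∈ Ω₀. -/
open Matrix

/-- `lam` is an intensity matrix: off-diagonal entries are nonnegative and rows sum to zero. -/
def IsIntensityMatrix {Ω₀ : Type*} [Fintype Ω₀] (lam : Matrix Ω₀ Ω₀ ℝ) : Prop :=
  (∀ i j, i ≠ j → 0 ≤ lam i j) ∧ ∀ i, ∑ j, lam i j = 0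

open scoped Nat in
lemma hasSum_exp_entry {n : Type*} [Fintype n] [DecidableEq n] (A : Matrix n n ℝ) (i j : n) :
    HasSum (fun k : ℕ => (k !⁻¹ : ℝ) * (A ^ k) i j) (NormedSpace.exp A i j) := by
  have h : HasSum (fun k : ℕ => (k !⁻¹ : ℝ) • A ^ k) (NormedSpace.exp A) := by
    letI : NormedRing (Matrix n n ℝ) := Matrix.linftyOpNormedRing
    letI : NormedAlgebra ℝ (Matrix n n ℝ) := Matrix.linftyOpNormedAlgebra
    exact NormedSpace.exp_series_hasSum_exp' A
  have h1 := Pi.hasSum.1 (Pi.hasSum.1 h i) j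
  simpa using h1

lemma exp_entry_nonneg {n : Type*} [Fintype n] [DecidableEq n] (A : Matrix n n ℝ)
    (hA : ∀ i j, 0 ≤ A i j) (i j : n) : 0 ≤ NormedSpace.exp A i j := by
  have hp : ∀ k : ℕ, ∀ i j, 0 ≤ (A ^ k) i j := by
    intro k
    induction k with
    | zero =>
      intro i j
      rw [pow_zero, Matrix.one_apply]
      split_ifs <;> norm_num
    | succ k ih =>
      intro i j
      rw [pow_succ, Matrix.mul_apply]
      exact Finset.sum_nonneg fun l _ => mul_nonneg (ih i l) (hA l j)
  exact (hasSum_exp_entry A i j).nonneg fun k => mul_nonneg (by positivity) (hp k i j)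

/-- for an intensity matrix `λ` and `u ≥ 0`, `exp(uλ)` is a stochastic
matrix: all entries are nonnegative and every row sums to one. -/
theorem exp_smul_intensity_isStochastic {Ω₀ : Type*} [Fintype Ω₀] [DecidableEq Ω₀]
    (lam : Matrix Ω₀ Ω₀ ℝ) (hlam : IsIntensityMatrix lam) (u : ℝ) (hu : 0 ≤ u) :
    (∀ i j, 0 ≤ NormedSpace.exp (u • lam) i j) ∧
    (∀ i, ∑ j, NormedSpace.exp (u • lam) i j = 1) := by
  obtain ⟨hoff, hrow⟩ := hlam
  constructor
  · intro i j
    set c : ℝ := ∑ i, |(u • lam) i i| with hc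
    have hdec : u • lam = (u • lam + diagonal fun _ => c) + diagonal fun _ => -c := by
      ext a b
      by_cases h : a = b
      · subst h
        simp
      · simp [h]
    have hcomm : Commute (u • lam + diagonal fun _ => c) (diagonal fun _ : Ω₀ => -c) := by
      ext a b
      rw [Matrix.mul_diagonal, Matrix.diagonal_mul, mul_comm]
    rw [hdec, Matrix.exp_add_of_commute _ _ hcomm, Matrix.exp_diagonal, Matrix.mul_diagonal]
    apply mul_nonneg
    · apply exp_entry_nonneg
      intro a b
      by_cases h : a = b
      · subst h
        have h1 : |(u • lam) a a| ≤ c :=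
          Finset.single_le_sum (f := fun i => |(u • lam) i i|) (fun _ _ => abs_nonneg _)
            (Finset.mem_univ a)
        have h2 := neg_abs_le ((u • lam) a a)
        rw [Matrix.add_apply, Matrix.diagonal_apply_eq]
        linarith
      · rw [Matrix.add_apply, Matrix.diagonal_apply_ne _ h, add_zero]
        exact mul_nonneg hu (hoff a b h)
    · rw [Pi.coe_exp, ← Real.exp_eq_exp_ℝ]
      exact (Real.exp_pos _).le
  · intro i
    have hs := hasSum_sum (s := Finset.univ) fun j _ => hasSum_exp_entry (u • lam) i j
    have hz : ∀ k : ℕ, k ≠ 0 → ∑ j, ((k.factorial : ℝ)⁻¹ * ((u • lam) ^ k) i j) = 0 := by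
      intro k hk
      obtain ⟨m, rfl⟩ := Nat.exists_eq_succ_of_ne_zero hk
      rw [← Finset.mul_sum]
      simp only [Nat.succ_eq_add_one, pow_succ, Matrix.mul_apply]
      rw [Finset.sum_comm]
      simp only [← Finset.mul_sum, Matrix.smul_apply, smul_eq_mul, hrow, mul_zero,
        Finset.sum_const_zero]
    have h0 := hasSum_single 0 hz
    rw [hs.unique h0]
    simp [Matrix.one_apply]
end

section
/- Let λ be an intensity matrix indexed by a finite set Ω₀, let d ⊆ Ω₀, and let u ≥ 0. Then the taboo transition matrix exp(u · I_{dᶜ} λ I_{dᶜ}) is substochastic: all of its entries are nonnegative and each of its row sums is at most 1. -/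
open Matrix
open scoped Classical

theorem exp_entry_hasSum {Ω₀ : Type*} [Fintype Ω₀] [DecidableEq Ω₀]
    (P : Matrix Ω₀ Ω₀ ℝ) (i j : Ω₀) :
    HasSum (fun n : ℕ => ((n.factorial : ℝ)⁻¹) * (P ^ n) i j) (NormedSpace.exp P i j) := by
  let _ : NormedRing (Matrix Ω₀ Ω₀ ℝ) := Matrix.linftyOpNormedRing
  let _ : NormedAlgebra ℝ (Matrix Ω₀ Ω₀ ℝ) := Matrix.linftyOpNormedAlgebra
  have h := NormedSpace.exp_series_hasSum_exp' (𝕂 := ℝ) P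
  have h1 := h.map (Matrix.entryAddMonoidHom ℝ i j)
    (show Continuous (fun M : Matrix Ω₀ Ω₀ ℝ => M i j) from
      continuous_id.matrix_elem i j)
  exact h1

theorem pow_substoch {Ω₀ : Type*} [Fintype Ω₀] [DecidableEq Ω₀]
    (P : Matrix Ω₀ Ω₀ ℝ) (c : ℝ) (hP : ∀ i j, 0 ≤ P i j) (hc : 0 ≤ c)
    (hr : ∀ i, ∑ j, P i j ≤ c) (n : ℕ) :
    (∀ i j, 0 ≤ (P ^ n) i j) ∧ ∀ i, ∑ j, (P ^ n) i j ≤ c ^ n := by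
  induction n with
  | zero =>
    refine ⟨fun i j => ?_, fun i => ?_⟩
    · rw [pow_zero, Matrix.one_apply]; split_ifs <;> norm_num
    · simp [Matrix.one_apply]
  | succ n ih =>
    refine ⟨fun i j => ?_, fun i => ?_⟩
    · rw [pow_succ, Matrix.mul_apply]
      exact Finset.sum_nonneg fun k _ => mul_nonneg (ih.1 i k) (hP k j)
    · simp only [pow_succ, Matrix.mul_apply]
      rw [Finset.sum_comm]
      simp only [← Finset.mul_sum]
      calc _ ≤ ∑ k, (P ^ n) i k * c :=
            Finset.sum_le_sum fun k _ => mul_le_mul_of_nonneg_left (hr k) (ih.1 i k)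
        _ = (∑ k, (P ^ n) i k) * c := by rw [Finset.sum_mul]
        _ ≤ c ^ n * c := mul_le_mul_of_nonneg_right (ih.2 i) hc

theorem exp_substoch_aux {Ω₀ : Type*} [Fintype Ω₀] [DecidableEq Ω₀]
    (A : Matrix Ω₀ Ω₀ ℝ) (hA : ∀ i j, i ≠ j → 0 ≤ A i j) (hr : ∀ i, ∑ j, A i j ≤ 0) :
    (∀ i j, 0 ≤ NormedSpace.exp A i j) ∧ (∀ i, ∑ j, NormedSpace.exp A i j ≤ 1) := by
  obtain ⟨c, hc, hcd⟩ : ∃ c : ℝ, 0 ≤ c ∧ ∀ i, 0 ≤ A i i + c := by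
    refine ⟨∑ i, |A i i|, Finset.sum_nonneg fun i _ => abs_nonneg _, fun i => ?_⟩
    have := Finset.single_le_sum (f := fun i => |A i i|) (fun i _ => abs_nonneg _)
      (Finset.mem_univ i)
    have h2 := neg_abs_le (A i i)
    linarith
  set D : Matrix Ω₀ Ω₀ ℝ := Matrix.diagonal (fun _ => -c) with hD
  set P : Matrix Ω₀ Ω₀ ℝ := A + Matrix.diagonal (fun _ => c) with hPdef
  have hP : ∀ i j, 0 ≤ P i j := by
    intro i j
    by_cases h : i = j
    · subst h; simpa [hPdef] using hcd i
    · simpa [hPdef, Matrix.diagonal_apply_ne _ h] using hA i j h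
  have hPr : ∀ i, ∑ j, P i j ≤ c := by
    intro i
    have := hr i
    simp [hPdef, Finset.sum_add_distrib, Matrix.diagonal_apply]
    linarith
  have hAP : A = D + P := by
    ext i j
    by_cases h : i = j
    · subst h; simp [hPdef, hD]
    · simp [hPdef, hD, Matrix.diagonal_apply_ne _ h]
  have hcomm : Commute D P := by
    have : D = Matrix.scalar Ω₀ (-c) := rfl
    rw [this]
    exact Matrix.scalar_commute _ (fun r => Commute.all _ r) _
  have hexp : ∀ i j, NormedSpace.exp A i j = Real.exp (-c) * NormedSpace.exp P i j := by
    intro i j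
    rw [hAP, Matrix.exp_add_of_commute _ _ hcomm, hD, Matrix.exp_diagonal,
      Matrix.diagonal_mul, Pi.coe_exp, Real.exp_eq_exp_ℝ]
  have hpow := pow_substoch P c hP hc hPr
  refine ⟨fun i j => ?_, fun i => ?_⟩
  · rw [hexp]
    exact mul_nonneg (Real.exp_pos _).le
      ((exp_entry_hasSum P i j).nonneg fun n => mul_nonneg (by positivity) ((hpow n).1 i j))
  · simp only [hexp, ← Finset.mul_sum]
    have h1 := hasSum_sum (s := Finset.univ) fun j _ => exp_entry_hasSum P i j
    have h2 : HasSum (fun n : ℕ => ((n.factorial : ℝ)⁻¹) * c ^ n) (Real.exp c) := by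
      rw [Real.exp_eq_exp_ℝ]
      exact NormedSpace.exp_series_hasSum_exp' (𝕂 := ℝ) c
    have h3 := hasSum_le (fun n => by
      rw [← Finset.mul_sum]
      exact mul_le_mul_of_nonneg_left ((hpow n).2 i) (by positivity)) h1 h2
    calc _ ≤ Real.exp (-c) * Real.exp c := mul_le_mul_of_nonneg_left h3 (Real.exp_pos _).le
      _ = 1 := by rw [← Real.exp_add]; simp

/-- for an intensity matrix `λ`, `d ⊆ Ω₀` and `u ≥ 0`, the taboo transition
matrix `exp(u I_{dᶜ} λ I_{dᶜ})` is substochastic: entries are nonnegative and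
row sums are at most one. -/
theorem exp_taboo_isSubstochastic {Ω₀ : Type*} [Fintype Ω₀] [DecidableEq Ω₀]
    (lam : Matrix Ω₀ Ω₀ ℝ) (hlam : IsIntensityMatrix lam)
    (d : Set Ω₀) (u : ℝ) (hu : 0 ≤ u) :
    (∀ i j, 0 ≤ NormedSpace.exp (u • (indMat dᶜ * lam * indMat dᶜ)) i j) ∧
    (∀ i, ∑ j, NormedSpace.exp (u • (indMat dᶜ * lam * indMat dᶜ)) i j ≤ 1) := by
  have hent : ∀ i j, (u • (indMat dᶜ * lam * indMat dᶜ)) i j =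
      u * ((if i ∈ dᶜ then 1 else 0) * lam i j * (if j ∈ dᶜ then 1 else 0)) := by
    intro i j
    rw [Matrix.smul_apply, indMat, Matrix.mul_diagonal, Matrix.diagonal_mul, smul_eq_mul]
    congr
  apply exp_substoch_aux
  · intro i j hij
    rw [hent]
    have := hlam.1 i j hij
    split_ifs <;> simp <;> positivity
  · intro i
    simp only [hent, ← Finset.mul_sum]
    refine mul_nonpos_of_nonneg_of_nonpos hu ?_
    by_cases hi : i ∈ dᶜ
    · refine le_trans ?_ (hlam.2 i).le
      refine Finset.sum_le_sum fun j _ => ?_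
      by_cases hj : j ∈ dᶜ
      · rw [if_pos hi, if_pos hj]; simp
      · have : 0 ≤ lam i j := hlam.1 i j (by rintro rfl; exact hj hi)
        rw [if_neg hj]; simpa using this
    · simp only [if_neg hi]; simp
end

section
/- Let λ be an intensity matrix indexed by a finite set Ω₀, let α be a row vector indexed by Ω₀ with nonnegative entries, let m ≥ 1, and for each n ∈ {1,…,m} let W_n, T_n ⊆ Ω₀ be disjoint sets (W_n ∩ T_n = ∅) and u_n ≥ 0. Then the hitting-time density expression α (∏_{n=1}^m exp(u_n · I_{W_n} λ I_{W_n}) · I_{W_n} λ I_{T_n}) 1 is nonnegative, where ∏_{n=1}^m M_n denotes the ordered product M_1 M_2 ⋯ M_m and 1 is the all-ones column vector indexed by Ω₀. -/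
open Matrix
open scoped Classical

theorem nonneg_exp_aux {Ω₀ : Type*} [Fintype Ω₀] [DecidableEq Ω₀]
    (A : Matrix Ω₀ Ω₀ ℝ) (hA : ∀ i j, 0 ≤ A i j) :
    ∀ i j, 0 ≤ (NormedSpace.exp A) i j := by
  letI : NormedRing (Matrix Ω₀ Ω₀ ℝ) := Matrix.linftyOpNormedRing
  letI : NormedAlgebra ℝ (Matrix Ω₀ Ω₀ ℝ) := Matrix.linftyOpNormedAlgebra
  intro i j
  have h := NormedSpace.exp_series_hasSum_exp' (𝕂 := ℝ) A
  have hp : ∀ n : ℕ, ∀ i j, 0 ≤ (A ^ n) i j := by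
    intro n
    induction n with
    | zero =>
      intro i j
      rw [pow_zero, Matrix.one_apply]
      split_ifs <;> norm_num
    | succ n ih =>
      intro i j
      rw [pow_succ, Matrix.mul_apply]
      exact Finset.sum_nonneg fun k _ => mul_nonneg (ih i k) (hA k j)
  have h2 := h.map (Matrix.entryAddMonoidHom ℝ i j) (continuous_id.matrix_elem i j)
  refine h2.nonneg fun n => ?_
  change 0 ≤ ((n.factorial : ℝ)⁻¹ • A ^ n) i j
  rw [Matrix.smul_apply, smul_eq_mul]
  exact mul_nonneg (by positivity) (hp n i j)

theorem nonneg_exp_metzler {Ω₀ : Type*} [Fintype Ω₀] [DecidableEq Ω₀]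
    (A : Matrix Ω₀ Ω₀ ℝ) (hA : ∀ i j, i ≠ j → 0 ≤ A i j) :
    ∀ i j, 0 ≤ (NormedSpace.exp A) i j := by
  intro i j
  set c : ℝ := ∑ k, |A k k| with hc
  have hcomm : Commute (A + Matrix.diagonal (fun _ => c)) (Matrix.diagonal (fun _ => -c)) := by
    ext a b
    simp [Matrix.mul_diagonal, Matrix.diagonal_mul, mul_comm]
  have hs : A = (A + Matrix.diagonal (fun _ => c)) + Matrix.diagonal (fun _ => -c) := by
    rw [add_assoc, Matrix.diagonal_add]
    simp
  rw [hs, Matrix.exp_add_of_commute _ _ hcomm, Matrix.exp_diagonal, Matrix.mul_diagonal]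
  refine mul_nonneg (nonneg_exp_aux _ ?_ i j) ?_
  · intro a b
    by_cases hab : a = b
    · subst hab
      have h1 : |A a a| ≤ c :=
        Finset.single_le_sum (f := fun k => |A k k|) (fun k _ => abs_nonneg _) (Finset.mem_univ a)
      have h2 := neg_abs_le (A a a)
      simp only [Matrix.add_apply, Matrix.diagonal_apply_eq]
      linarith
    · simpa [Matrix.diagonal_apply_ne _ hab] using hA a b hab
  · rw [Pi.coe_exp, ← Real.exp_eq_exp_ℝ]
    exact (Real.exp_pos _).le

theorem nonneg_list_prod {Ω₀ : Type*} [Fintype Ω₀] [DecidableEq Ω₀]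
    (l : List (Matrix Ω₀ Ω₀ ℝ)) (hl : ∀ A ∈ l, ∀ i j, 0 ≤ A i j) :
    ∀ i j, 0 ≤ l.prod i j := by
  induction l with
  | nil =>
    intro i j
    rw [List.prod_nil, Matrix.one_apply]
    split_ifs <;> norm_num
  | cons A l ih =>
    intro i j
    rw [List.prod_cons, Matrix.mul_apply]
    exact Finset.sum_nonneg fun k _ => mul_nonneg (hl A (by simp) i k)
      (ih (fun B hB => hl B (by simp [hB])) k j)

/-- nonnegativity of the hitting-time density expression
`α (∏ₙ exp(uₙ 𝛌(Wₙ)) 𝛌(Wₙ,Tₙ)) 1` for an intensity matrix `λ`, a nonnegative row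
vector `α`, nonnegative times `uₙ` and disjoint sets `Wₙ, Tₙ`. -/
theorem density_expression_nonneg {Ω₀ : Type*} [Fintype Ω₀] [DecidableEq Ω₀]
    (lam : Matrix Ω₀ Ω₀ ℝ) (hlam : IsIntensityMatrix lam)
    (α : Ω₀ → ℝ) (hα : ∀ i, 0 ≤ α i)
    (m : ℕ) (hm : 1 ≤ m)
    (W T : Fin m → Set Ω₀) (hWT : ∀ n, W n ∩ T n = ∅)
    (u : Fin m → ℝ) (hu : ∀ n, 0 ≤ u n) :
    0 ≤ (α ᵥ* (List.ofFn fun n =>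
        NormedSpace.exp (u n • (indMat (W n) * lam * indMat (W n))) *
          (indMat (W n) * lam * indMat (T n))).prod) ⬝ᵥ
      (fun _ => (1 : ℝ)) := by
  have key : ∀ i j, 0 ≤ (List.ofFn fun n =>
        NormedSpace.exp (u n • (indMat (W n) * lam * indMat (W n))) *
          (indMat (W n) * lam * indMat (T n))).prod i j := by
    apply nonneg_list_prod
    intro A hA
    rw [List.mem_ofFn] at hA
    obtain ⟨n, rfl⟩ := hA
    intro i j
    rw [Matrix.mul_apply]
    refine Finset.sum_nonneg fun k _ => mul_nonneg (nonneg_exp_metzler _ ?_ i k) ?_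
    · intro a b hab
      have := hlam.1 a b hab
      rw [Matrix.smul_apply, smul_eq_mul]
      refine mul_nonneg (hu n) ?_
      rw [indMat, Matrix.mul_diagonal, Matrix.diagonal_mul]
      refine mul_nonneg (mul_nonneg ?_ this) ?_ <;> split_ifs <;> norm_num
    · rw [indMat, indMat, Matrix.mul_diagonal, Matrix.diagonal_mul]
      by_cases hk : k ∈ W n
      · by_cases hj : j ∈ T n
        · have hkj : k ≠ j := by
            rintro rfl
            have : k ∈ W n ∩ T n := ⟨hk, hj⟩
            rw [hWT n] at this
            exact this
          simpa [hk, hj] using hlam.1 k j hkj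
        · simp [hj]
      · simp [hk]
  refine Finset.sum_nonneg fun j _ => mul_nonneg ?_ zero_le_one
  exact Finset.sum_nonneg fun i _ => mul_nonneg (hα i) (key i j)
end
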